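/- Jensen-type inequality for the log-concave profile likelihood functional (Theorem A.6, inequality part). Let X and Y be independent real random variables with respective distributions P and Q, where Q ∈ 𝒬*, P(X ≥ 0) = 1 and E log X = m < ∞ (m ∈ [−∞, ∞)). Let R denote the distribution of XY. Then L(R) ≤ L(Q) − m. -/

import Mathlib

open MeasureTheory ProbabilityTheory Filter Topology
open scoped ENNReal NNReal

noncomputable section

/-- The exponential map `EReal → ℝ≥0∞` (sends `⊥` to `0` and `⊤` to `∞`). -/
def expEReal (x : EReal) : ℝ≥0∞ :=
  if x = ⊥ then 0 else if x = ⊤ then ⊤ else ENNReal.ofReal (Real.exp x.toReal)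

/-- Real-valued exponential of an extended real (sends `⊥` to `0`). -/
def expE (x : EReal) : ℝ := (expEReal x).toReal

/-- Extended-real logarithm of a real number (`⊥` for nonpositive input). -/
def elog (r : ℝ) : EReal := if r ≤ 0 then (⊥ : EReal) else ((Real.log r : ℝ) : EReal)

/-- Concavity for `EReal`-valued functions on `ℝ`. -/
def ErealConcaveOn (φ : ℝ → EReal) : Prop :=
  ∀ x y t : ℝ, 0 ≤ t → t ≤ 1 →
    (t : EReal) * φ x + ((1 - t : ℝ) : EReal) * φ y ≤ φ (t * x + (1 - t) * y)

/-- The class `Φ` of concave, upper semicontinuous, coercive functions `ℝ → [-∞, ∞)`. -/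
def MemPhi (φ : ℝ → EReal) : Prop :=
  (∀ x, φ x ≠ ⊤) ∧ ErealConcaveOn φ ∧ UpperSemicontinuous φ ∧
    Tendsto φ (cocompact ℝ) (𝓝 ⊥)

/-- Positive part of an extended real, valued in `ℝ≥0∞`. -/
def erealPosPart (x : EReal) : ℝ≥0∞ := if x = ⊤ then ⊤ else ENNReal.ofReal x.toReal

/-- Integral of an `EReal`-valued function against a measure on `ℝ`. -/
def integralEReal (Q : Measure ℝ) (φ : ℝ → EReal) : EReal :=
  ((∫⁻ x, erealPosPart (φ x) ∂Q : ℝ≥0∞) : EReal)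
    - ((∫⁻ x, erealPosPart (-(φ x)) ∂Q : ℝ≥0∞) : EReal)

/-- `𝒬*`: probability distributions on `ℝ` with finite first moment and nonzero variance. -/
def MemQstar (Q : Measure ℝ) : Prop :=
  IsProbabilityMeasure Q ∧ Integrable (fun x : ℝ => x) Q ∧ ¬ ∃ c : ℝ, Q = Measure.dirac c

open Classical in
/-- The profile log-likelihood functional `L`. -/
def Lfunc (Q : Measure ℝ) : EReal :=
  if ¬ Integrable (fun x : ℝ => x) Q then ⊥
  else if ∃ c : ℝ, Q = Measure.dirac c then ⊤
  else sSup {r : EReal | ∃ φ, MemPhi φ ∧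
    r = integralEReal Q φ - ((∫⁻ x, expEReal (φ x) : ℝ≥0∞) : EReal) + 1}

/-- `ψ` is the log-concave projection of `Q`: a maximizer over `Φ` of
`φ ↦ ∫ φ dQ − ∫ e^φ dx + 1`. -/
def IsLogConcaveProj (Q : Measure ℝ) (ψ : ℝ → EReal) : Prop :=
  MemPhi ψ ∧ ∀ φ, MemPhi φ →
    integralEReal Q φ - ((∫⁻ x, expEReal (φ x) : ℝ≥0∞) : EReal) + 1 ≤
      integralEReal Q ψ - ((∫⁻ x, expEReal (ψ x) : ℝ≥0∞) : EReal) + 1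

/-- A nonnegative function on `ℝ` is log-concave. -/
def IsLogConcaveFn (f : ℝ → ℝ) : Prop :=
  (∀ x, 0 ≤ f x) ∧ ∀ x y t : ℝ, 0 ≤ t → t ≤ 1 →
    f x ^ t * f y ^ (1 - t) ≤ f (t * x + (1 - t) * y)

/-- A log-concave probability density on `ℝ`. -/
def IsLogConcaveDensity (f : ℝ → ℝ) : Prop :=
  IsLogConcaveFn f ∧ (∫ x, f x) = 1

/-- `f` is the best log-concave approximation `f₀*` of `Q`. -/
def IsBestLogConcaveApprox (Q : Measure ℝ) (f : ℝ → ℝ) : Prop :=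
  IsLogConcaveDensity f ∧ ∀ g, IsLogConcaveDensity g →
    integralEReal Q (fun x => elog (g x)) ≤ integralEReal Q (fun x => elog (f x))

/-- The first Mallows (Wasserstein-1) distance between two measures on `ℝ`. -/
def mallows1 (μ ν : Measure ℝ) : ℝ≥0∞ :=
  ⨅ (γ : Measure (ℝ × ℝ)) (_ : γ.map Prod.fst = μ) (_ : γ.map Prod.snd = ν),
    ∫⁻ p, ENNReal.ofReal |p.1 - p.2| ∂γ

/-- A family of random variables is i.i.d. with common distribution `Q`. -/
def IsIID {Ω : Type*} [MeasurableSpace Ω] (μ : Measure Ω) {ι : Type*}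
    (ε : ι → Ω → ℝ) (Q : Measure ℝ) : Prop :=
  iIndepFun ε μ ∧ ∀ i, μ.map (ε i) = Q

/-- ARMA polynomial `A_θ(z) = 1 - ∑ aᵢ zⁱ`. -/
def armaA {p : ℕ} (a : Fin p → ℝ) (z : ℂ) : ℂ := 1 - ∑ i : Fin p, (a i : ℂ) * z ^ ((i : ℕ) + 1)

/-- ARMA polynomial `B_θ(z) = 1 + ∑ bᵢ zⁱ`. -/
def armaB {q : ℕ} (b : Fin q → ℝ) (z : ℂ) : ℂ := 1 + ∑ i : Fin q, (b i : ℂ) * z ^ ((i : ℕ) + 1)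

/-- GARCH polynomial `𝒜_θ(z) = ∑ αᵢ zⁱ`. -/
def garchA {r : ℕ} (α : Fin r → ℝ) (z : ℂ) : ℂ := ∑ i : Fin r, (α i : ℂ) * z ^ ((i : ℕ) + 1)

/-- GARCH polynomial `ℬ_θ(z) = 1 - ∑ βᵢ zⁱ`. -/
def garchB {s : ℕ} (β : Fin s → ℝ) (z : ℂ) : ℂ := 1 - ∑ i : Fin s, (β i : ℂ) * z ^ ((i : ℕ) + 1)

/-- The last coefficient of a coefficient vector (`0` if the vector is empty). -/
def lastC {k : ℕ} (v : Fin k → ℝ) : ℝ := if h : 0 < k then v ⟨k - 1, Nat.sub_lt h one_pos⟩ else 0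

/-- The ARMA log-concave objective
`Λ_n(φ, θ) = (1/n) ∑ φ(ε̃ₜ(θ)) − ∫ e^φ + 1`, as a function of `φ` and the residuals. -/
def armaLam (n : ℕ) (φ : ℝ → EReal) (res : ℤ → ℝ) : EReal :=
  ((1 / (n : ℝ) : ℝ) : EReal) * ∑ t ∈ Finset.Icc 1 n, φ (res (t : ℤ))
    - ((∫⁻ x, expEReal (φ x) : ℝ≥0∞) : EReal) + 1

/-- The ARMA-GARCH log-concave objective
`Λ_n(φ, θ) = (1/n) ∑ φ(η̃ₜ/σ̃ₜ) − (1/2n) ∑ log σ̃ₜ² − ∫ e^φ + 1`. -/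
def garchLam (n : ℕ) (φ : ℝ → EReal) (eta sig2 : ℤ → ℝ) : EReal :=
  ((1 / (n : ℝ) : ℝ) : EReal) * ∑ t ∈ Finset.Icc 1 n, φ (eta (t : ℤ) / Real.sqrt (sig2 (t : ℤ)))
    - (((1 / (2 * (n : ℝ))) * ∑ t ∈ Finset.Icc 1 n, Real.log (sig2 (t : ℤ)) : ℝ) : EReal)
    - ((∫⁻ x, expEReal (φ x) : ℝ≥0∞) : EReal) + 1

end

lemma aux_toReal_neg (a : EReal) : (-a).toReal = -a.toReal := by simp

lemma aux_meas_exp : Measurable expEReal := by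
  unfold expEReal
  refine Measurable.ite (measurableSet_singleton _) measurable_const ?_
  refine Measurable.ite (measurableSet_singleton _) measurable_const ?_
  exact (Real.measurable_exp.comp measurable_ereal_toReal).ennreal_ofReal

lemma aux_meas_pos : Measurable erealPosPart := by
  unfold erealPosPart
  refine Measurable.ite (measurableSet_singleton _) measurable_const ?_
  exact measurable_ereal_toReal.ennreal_ofReal

lemma aux_exp_add (a : EReal) (ha : a ≠ ⊤) (x : ℝ) (hx : 0 < x) :
    expEReal (a + ((Real.log x : ℝ) : EReal)) = ENNReal.ofReal x * expEReal a := by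
  induction a with
  | bot => simp [expEReal]
  | top => exact absurd rfl ha
  | coe r =>
    rw [← EReal.coe_add]
    simp only [expEReal, EReal.coe_ne_bot, EReal.coe_ne_top, if_false, EReal.toReal_coe]
    rw [Real.exp_add, Real.exp_log hx, mul_comm, ENNReal.ofReal_mul hx.le]

lemma aux_fin (Q : Measure ℝ) (ψ : ℝ → EReal) (hψ : Measurable ψ)
    (hp : ∫⁻ x, erealPosPart (ψ x) ∂Q ≠ ⊤) (hn : ∫⁻ x, erealPosPart (-(ψ x)) ∂Q ≠ ⊤) :
    (∀ᵐ x ∂Q, ψ x ≠ ⊤ ∧ ψ x ≠ ⊥) ∧ Integrable (fun x => (ψ x).toReal) Q := by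
  have h1 := ae_lt_top (aux_meas_pos.comp hψ) hp
  have h2 := ae_lt_top (aux_meas_pos.comp hψ.neg) hn
  have h3 : ∀ᵐ x ∂Q, ψ x ≠ ⊤ ∧ ψ x ≠ ⊥ := by
    filter_upwards [h1, h2] with x a b
    constructor
    · intro h; simp [erealPosPart, h] at a
    · intro h; simp [erealPosPart, h] at b
  refine ⟨h3, (measurable_ereal_toReal.comp hψ).aestronglyMeasurable, ?_⟩
  rw [hasFiniteIntegral_iff_norm]
  have : ∫⁻ x, ENNReal.ofReal ‖(ψ x).toReal‖ ∂Q
      ≤ ∫⁻ x, (erealPosPart (ψ x) + erealPosPart (-(ψ x))) ∂Q := by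
    refine lintegral_mono_ae ?_
    filter_upwards [h3] with x hx
    obtain ⟨a, b⟩ := hx
    have b' : -(ψ x) ≠ ⊤ := by simpa using b
    simp only [erealPosPart, a, b', if_false]
    rw [Real.norm_eq_abs]
    rcases le_total 0 (ψ x).toReal with h | h
    · rw [abs_of_nonneg h]; exact le_add_of_nonneg_right zero_le
    · rw [abs_of_nonpos h, ← aux_toReal_neg]; exact le_add_of_nonneg_left zero_le
  refine lt_of_le_of_lt this ?_
  have hm : Measurable fun x => erealPosPart (ψ x) := aux_meas_pos.comp hψ
  rw [lintegral_add_left hm]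
  exact ENNReal.add_lt_top.2 ⟨hp.lt_top, hn.lt_top⟩

lemma aux_int (Q : Measure ℝ) (ψ : ℝ → EReal)
    (h : ∀ᵐ x ∂Q, ψ x ≠ ⊤ ∧ ψ x ≠ ⊥) (hi : Integrable (fun x => (ψ x).toReal) Q) :
    integralEReal Q ψ = ((∫ x, (ψ x).toReal ∂Q : ℝ) : EReal) := by
  have e1 : ∫⁻ x, erealPosPart (ψ x) ∂Q = ∫⁻ x, ENNReal.ofReal (ψ x).toReal ∂Q :=
    lintegral_congr_ae (by filter_upwards [h] with x hx; simp [erealPosPart, hx.1])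
  have e2 : ∫⁻ x, erealPosPart (-(ψ x)) ∂Q = ∫⁻ x, ENNReal.ofReal (-(ψ x).toReal) ∂Q :=
    lintegral_congr_ae (by
      filter_upwards [h] with x hx
      simp [erealPosPart, hx.2])
  rw [integralEReal, e1, e2, integral_eq_lintegral_pos_part_sub_lintegral_neg_part hi,
    EReal.coe_sub]
  have f1 : ∫⁻ x, ENNReal.ofReal (ψ x).toReal ∂Q ≠ ⊤ := hi.lintegral_lt_top.ne
  have f2 : ∫⁻ x, ENNReal.ofReal (-(ψ x).toReal) ∂Q ≠ ⊤ := hi.neg.lintegral_lt_top.ne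
  rw [← EReal.coe_ennreal_toReal f1, ← EReal.coe_ennreal_toReal f2]

lemma aux_phi_bdd (φ : ℝ → EReal) (h : MemPhi φ) : ∃ M : ℝ, ∀ x, φ x ≤ (M : EReal) := by
  obtain ⟨h1, -, h3, h4⟩ := h
  have ev : ∀ᶠ x in cocompact ℝ, φ x < 0 := h4.eventually_lt_const (by simp)
  obtain ⟨K, hK, hs⟩ := mem_cocompact.1 ev
  have hK' : IsCompact (insert 0 K) := hK.insert 0
  obtain ⟨a, -, ha⟩ := UpperSemicontinuousOn.exists_isMaxOn (Set.insert_nonempty 0 K) hK'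
    (h3.upperSemicontinuousOn _)
  refine ⟨max (φ a).toReal 0, fun x => ?_⟩
  by_cases hx : x ∈ K
  · refine (ha (Set.mem_insert_of_mem 0 hx)).trans ((EReal.le_coe_toReal (h1 a)).trans ?_)
    exact EReal.coe_le_coe_iff.2 (le_max_left _ _)
  · refine (le_of_lt (hs hx)).trans ?_
    exact_mod_cast le_max_right _ _

lemma aux_phi_scale (φ : ℝ → EReal) (h : MemPhi φ) (x : ℝ) (hx : 0 < x) :
    MemPhi (fun y => φ (x * y) + ((Real.log x : ℝ) : EReal)) := by
  obtain ⟨h1, h2, h3, h4⟩ := h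
  refine ⟨fun y => by simpa using EReal.add_ne_top (h1 _) (EReal.coe_ne_top _), ?_, ?_, ?_⟩
  · intro a b t ht0 ht1
    have := h2 (x * a) (x * b) t ht0 ht1
    have e : t * (x * a) + (1 - t) * (x * b) = x * (t * a + (1 - t) * b) := by ring
    rw [e] at this
    rw [EReal.left_distrib_of_nonneg_of_ne_top (by exact_mod_cast ht0) (EReal.coe_ne_top _),
      EReal.left_distrib_of_nonneg_of_ne_top (by exact_mod_cast (sub_nonneg.2 ht1))
        (EReal.coe_ne_top _), add_add_add_comm]
    refine add_le_add this ?_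
    rw [← EReal.coe_mul, ← EReal.coe_mul, ← EReal.coe_add]
    apply le_of_eq; congr 1; ring
  · have hc : UpperSemicontinuous (fun y => φ (x * y)) := h3.comp (by fun_prop)
    refine hc.add' upperSemicontinuous_const ?_
    intro y
    exact EReal.continuousAt_add (Or.inr (EReal.coe_ne_bot _)) (Or.inr (EReal.coe_ne_top _))
  · have hc := h4.comp (Filter.tendsto_cocompact_mul_left₀ hx.ne')
    have := EReal.continuousAt_add (p := ((⊥ : EReal), ((Real.log x : ℝ) : EReal)))
      (Or.inr (EReal.coe_ne_bot _)) (Or.inr (EReal.coe_ne_top _))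
    have h5 := this.tendsto.comp (hc.prodMk_nhds (tendsto_const_nhds (x := ((Real.log x : ℝ) : EReal))))
    simpa [Function.comp_def] using h5

lemma aux_exp_scale (φ : ℝ → EReal) (h : MemPhi φ) (x : ℝ) (hx : 0 < x) :
    ∫⁻ y, expEReal (φ (x * y) + ((Real.log x : ℝ) : EReal)) = ∫⁻ y, expEReal (φ y) := by
  have hm : Measurable φ := h.2.2.1.measurable
  have hm2 : Measurable fun y => expEReal (φ y) := aux_meas_exp.comp hm
  simp_rw [aux_exp_add _ (h.1 _) x hx]
  have hm3 : Measurable fun y => expEReal (φ (x * y)) := hm2.comp (measurable_const_mul x)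
  rw [lintegral_const_mul _ hm3]
  rw [← lintegral_map (f := fun y => expEReal (φ y)) hm2 (measurable_const_mul x),
    Real.map_volume_mul_left hx.ne', lintegral_smul_measure, smul_eq_mul, ← mul_assoc,
    ← ENNReal.ofReal_mul hx.le, abs_of_pos (inv_pos.2 hx), mul_inv_cancel₀ hx.ne']
  simp

lemma aux_exp_abs : ∫⁻ x : ℝ, expEReal (((-|x| : ℝ)) : EReal) ≠ ⊤ := by
  simp only [expEReal, EReal.coe_ne_bot, EReal.coe_ne_top, if_false, EReal.toReal_coe]
  have h : Integrable (fun x : ℝ => 2 * (1 + x ^ 2)⁻¹) := integrable_inv_one_add_sq.const_mul 2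
  refine (lt_of_le_of_lt (lintegral_mono fun x => ENNReal.ofReal_le_ofReal ?_)
    h.lintegral_lt_top).ne
  have := Real.quadratic_le_exp_of_nonneg (abs_nonneg x)
  rw [sq_abs] at this
  rw [Real.exp_neg, ← div_eq_mul_inv, inv_le_comm₀ (Real.exp_pos _) (by positivity), inv_div]
  linarith [abs_nonneg x]

lemma aux_phi_abs : MemPhi (fun x => ((-|x| : ℝ) : EReal)) := by
  refine ⟨fun x => EReal.coe_ne_top _, ?_, ?_, ?_⟩
  · intro x y t h0 h1
    rw [← EReal.coe_mul, ← EReal.coe_mul, ← EReal.coe_add]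
    refine EReal.coe_le_coe_iff.2 ?_
    have := abs_add_le (t * x) ((1 - t) * y)
    rw [abs_mul, abs_mul, abs_of_nonneg h0, abs_of_nonneg (sub_nonneg.2 h1)] at this
    linarith
  · exact (continuous_coe_real_ereal.comp (by fun_prop)).upperSemicontinuous
  · rw [EReal.tendsto_coe_nhds_bot_iff]
    exact tendsto_neg_atTop_atBot.comp (tendsto_norm_cocompact_atTop (E := ℝ))

lemma aux_L_ge (Q : Measure ℝ) (hQ : MemQstar Q) (φ : ℝ → EReal) (h : MemPhi φ) :
    integralEReal Q φ - ((∫⁻ x, expEReal (φ x) : ℝ≥0∞) : EReal) + 1 ≤ Lfunc Q := by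
  unfold Lfunc
  rw [if_neg (not_not.2 hQ.2.1), if_neg hQ.2.2]
  exact le_sSup ⟨φ, h, rfl⟩

lemma aux_L_ne_bot (Q : Measure ℝ) (hQ : MemQstar Q) : Lfunc Q ≠ ⊥ := by
  have h := aux_L_ge Q hQ _ aux_phi_abs
  rw [aux_int Q _ (by simp) (by simpa using hQ.2.1.abs),
    ← EReal.coe_ennreal_toReal aux_exp_abs, ← EReal.coe_sub, ← EReal.coe_one, ← EReal.coe_add] at h
  intro h'
  rw [h', le_bot_iff] at h
  exact EReal.coe_ne_bot _ h

lemma aux_split (P : Measure ℝ) (ψ : ℝ → EReal) (hψ : Measurable ψ)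
    (h1 : integralEReal P ψ ≠ ⊤) (h2 : integralEReal P ψ ≠ ⊥) :
    (∀ᵐ x ∂P, ψ x ≠ ⊤ ∧ ψ x ≠ ⊥) ∧ Integrable (fun x => (ψ x).toReal) P := by
  have hn : ∫⁻ x, erealPosPart (-(ψ x)) ∂P ≠ ⊤ := by
    intro h
    apply h2
    rw [integralEReal, h]; simp
  refine aux_fin P ψ hψ ?_ hn
  intro h
  apply h1
  rw [integralEReal, h, ← EReal.coe_ennreal_toReal hn]
  simp

lemma aux_meas_elog : Measurable elog := by
  unfold elog
  refine Measurable.ite measurableSet_Iic measurable_const ?_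
  exact Real.measurable_log.coe_real_ereal

/-- Key inequality for one `φ`, in product form. -/
lemma aux_key (P Q : Measure ℝ) [IsProbabilityMeasure P] [IsProbabilityMeasure Q]
    (hQ : MemQstar Q) (hpos : ∀ᵐ x ∂P, 0 < x) (hli : Integrable Real.log P)
    (φ : ℝ → EReal) (hφ : MemPhi φ) :
    integralEReal ((P.prod Q).map (fun p => p.1 * p.2)) φ
      - ((∫⁻ x, expEReal (φ x) : ℝ≥0∞) : EReal) + 1
      ≤ Lfunc Q - ((∫ x, Real.log x ∂P : ℝ) : EReal) := by
  have hm : Measurable φ := hφ.2.2.1.measurable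
  have hmul : Measurable (fun p : ℝ × ℝ => p.1 * p.2) := by fun_prop
  set ν := (P.prod Q).map (fun p : ℝ × ℝ => p.1 * p.2) with hR
  have : IsProbabilityMeasure ν := Measure.isProbabilityMeasure_map hmul.aemeasurable
  by_cases hI : ∫⁻ x, expEReal (φ x) = ⊤
  · rw [hI]; simp
  by_cases hbot : integralEReal ν φ = ⊥
  · rw [hbot]; simp
  obtain ⟨M, hM⟩ := aux_phi_bdd φ hφ
  have htop : integralEReal ν φ ≠ ⊤ := by
    have hp : ∫⁻ x, erealPosPart (φ x) ∂ν ≤ ENNReal.ofReal M := by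
      calc ∫⁻ x, erealPosPart (φ x) ∂ν ≤ ∫⁻ x, ENNReal.ofReal M ∂ν := by
            refine lintegral_mono fun x => ?_
            simp only [erealPosPart, hφ.1 x, if_false]
            rcases eq_or_ne (φ x) ⊥ with h | h
            · simp [h]
            · exact ENNReal.ofReal_le_ofReal
                (by simpa using EReal.toReal_le_toReal (hM x) h (EReal.coe_ne_top _))
        _ = _ := by simp
    have hp' : ∫⁻ x, erealPosPart (φ x) ∂ν ≠ ⊤ := (hp.trans_lt ENNReal.ofReal_lt_top).ne
    intro h
    rw [integralEReal, ← EReal.coe_ennreal_toReal hp', sub_eq_add_neg] at h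
    refine EReal.add_ne_top (EReal.coe_ne_top _) ?_ h
    simp
  obtain ⟨hae, hint⟩ := aux_split ν φ hm htop hbot
  rw [aux_int ν φ hae hint]
  have hmR : Measurable (fun x => (φ x).toReal) := measurable_ereal_toReal.comp hm
  rw [hR, integral_map hmul.aemeasurable hmR.aestronglyMeasurable]
  have hint2 : Integrable (fun p : ℝ × ℝ => (φ (p.1 * p.2)).toReal) (P.prod Q) :=
    (integrable_map_measure hmR.aestronglyMeasurable hmul.aemeasurable).1 hint
  have hae2 : ∀ᵐ p ∂(P.prod Q), φ (p.1 * p.2) ≠ ⊤ ∧ φ (p.1 * p.2) ≠ ⊥ :=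
    ae_of_ae_map hmul.aemeasurable hae
  have hae3 := Measure.ae_ae_of_ae_prod hae2
  have hint3 := hint2.prod_right_ae
  rw [integral_prod _ hint2]
  rcases eq_or_ne (Lfunc Q) ⊤ with hL | hL
  · rw [hL]; simp
  have hL' := aux_L_ne_bot Q hQ
  lift Lfunc Q to ℝ using ⟨hL, hL'⟩ with l hl
  rw [← EReal.coe_ennreal_toReal hI, ← EReal.coe_sub, ← EReal.coe_one, ← EReal.coe_add,
    ← EReal.coe_sub]
  refine EReal.coe_le_coe_iff.2 ?_
  set c := (∫⁻ x, expEReal (φ x)).toReal with hc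
  have hpt : ∀ᵐ x ∂P, (∫ y, (φ (x * y)).toReal ∂Q) + Real.log x ≤ l + c - 1 := by
    filter_upwards [hae3, hint3, hpos] with x h1 h2 hx
    have h3 := aux_L_ge Q hQ _ (aux_phi_scale φ hφ x hx)
    have h4 : ∀ᵐ y ∂Q, (φ (x * y) + ((Real.log x : ℝ) : EReal)).toReal
        = (φ (x * y)).toReal + Real.log x := by
      filter_upwards [h1] with y hy
      rw [EReal.toReal_add hy.1 hy.2 (EReal.coe_ne_top _) (EReal.coe_ne_bot _), EReal.toReal_coe]
    have h5 : Integrable (fun y => (φ (x * y)).toReal + Real.log x) Q :=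
      Integrable.add h2 (integrable_const _)
    rw [aux_exp_scale φ hφ x hx, aux_int Q _ ?_ (h5.congr (h4.mono fun _ h => h.symm)),
      integral_congr_ae h4, integral_add h2 (integrable_const _), ← hl,
      ← EReal.coe_ennreal_toReal hI, ← EReal.coe_sub, ← EReal.coe_one, ← EReal.coe_add,
      EReal.coe_le_coe_iff] at h3
    · simp at h3
      linarith
    · filter_upwards [h1] with y hy
      refine ⟨EReal.add_ne_top hy.1 (EReal.coe_ne_top _), ?_⟩
      simp [EReal.add_eq_bot_iff, hy.2]
  have hi4 : Integrable (fun x => ∫ y, (φ (x * y)).toReal ∂Q) P := hint2.integral_prod_left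
  have := integral_mono_ae (hi4.add hli) (integrable_const (l + c - 1)) hpt
  simp only [Pi.add_apply] at this
  rw [integral_add hi4 hli] at this
  simp at this
  linarith

lemma aux_main
    {Ω : Type*} [MeasurableSpace Ω] (μ : Measure Ω) [IsProbabilityMeasure μ]
    (X Y : Ω → ℝ) (hX : Measurable X) (hY : Measurable Y)
    (hind : IndepFun X Y μ)
    (hQ : MemQstar (μ.map Y))
    (m : EReal) (hm : m ≠ ⊤)
    (hlog : integralEReal (μ.map X) (fun x => elog x) = m) :
    Lfunc (μ.map (fun ω => X ω * Y ω)) ≤ Lfunc (μ.map Y) - m := by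
  rcases eq_or_ne m ⊥ with hb | hb
  · subst hb
    have : Lfunc (μ.map Y) - ⊥ = ⊤ := by
      rw [sub_eq_add_neg, EReal.neg_bot]
      exact EReal.add_top_of_ne_bot (aux_L_ne_bot _ hQ)
    rw [this]; exact le_top
  have : IsProbabilityMeasure (μ.map X) := Measure.isProbabilityMeasure_map hX.aemeasurable
  have : IsProbabilityMeasure (μ.map Y) := Measure.isProbabilityMeasure_map hY.aemeasurable
  obtain ⟨h1, h2⟩ := aux_split (μ.map X) (fun x => elog x) aux_meas_elog (hlog ▸ hm) (hlog ▸ hb)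
  have hpos : ∀ᵐ x ∂(μ.map X), 0 < x := by
    filter_upwards [h1] with x hx
    by_contra h
    exact hx.2 (by simp [elog, not_lt.1 h])
  have heq : (fun x => (elog x).toReal) =ᵐ[μ.map X] Real.log := by
    filter_upwards [hpos] with x hx
    simp [elog, not_le.2 hx]
  have hli : Integrable Real.log (μ.map X) := h2.congr heq
  rw [← hlog, aux_int _ _ h1 h2, integral_congr_ae heq]
  have hmul : Measurable (fun p : ℝ × ℝ => p.1 * p.2) := by fun_prop
  have hprod := (indepFun_iff_map_prod_eq_prod_map_map hX.aemeasurable hY.aemeasurable).1 hind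
  have hRe : μ.map (fun ω => X ω * Y ω)
      = ((μ.map X).prod (μ.map Y)).map (fun p : ℝ × ℝ => p.1 * p.2) := by
    rw [← hprod, Measure.map_map hmul (hX.prodMk hY)]
    rfl
  rw [hRe]
  generalize hP' : μ.map X = P at *
  generalize hQ' : μ.map Y = Q at *
  conv_lhs => unfold Lfunc
  split_ifs with g1 g2
  · exfalso
    obtain ⟨c, hc⟩ := g2
    have k1 : ∀ᵐ z ∂((P.prod Q).map (fun p : ℝ × ℝ => p.1 * p.2)), z = c := by
      rw [hc, ae_dirac_eq]; rfl
    have k2 := Measure.ae_ae_of_ae_prod (ae_of_ae_map hmul.aemeasurable k1)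
    obtain ⟨x, hx, hx0⟩ := (k2.and hpos).exists
    have k3 : ∀ᵐ y ∂Q, y = c / x := by
      filter_upwards [hx] with y hy
      rw [eq_div_iff hx0.ne', mul_comm]; exact hy
    refine hQ.2.2 ⟨c / x, ?_⟩
    calc Q = Q.map id := Measure.map_id.symm
      _ = Q.map (fun _ => c / x) := Measure.map_congr k3
      _ = _ := by simp [Measure.map_const]
  · refine sSup_le ?_
    rintro r ⟨φ, hφ, rfl⟩
    exact aux_key P Q hQ hpos hli φ hφ
  · exact bot_le

/-- **Theorem A.6, inequality part (Jensen-type inequality for `L`).**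
If `X ⟂ Y`, `Law(Y) = Q ∈ 𝒬*`, `X ≥ 0` a.s. and `E log X = m < ∞` (with `m ∈ [−∞, ∞)`),
then `L(Law(XY)) ≤ L(Q) − m`. -/
theorem Lfunc_mul_le
    {Ω : Type*} [MeasurableSpace Ω] (μ : Measure Ω) [IsProbabilityMeasure μ]
    (X Y : Ω → ℝ) (hX : Measurable X) (hY : Measurable Y)
    (hind : IndepFun X Y μ)
    (hXpos : ∀ᵐ ω ∂μ, 0 ≤ X ω)
    (hQ : MemQstar (μ.map Y))
    (m : EReal) (hm : m ≠ ⊤)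
    (hlog : integralEReal (μ.map X) (fun x => elog x) = m) :
    Lfunc (μ.map (fun ω => X ω * Y ω)) ≤ Lfunc (μ.map Y) - m := by
  exact aux_main μ X Y hX hY hind hQ m hm hlog
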